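/- Let M₁ < … < M_L be pairwise coprime positive integers, Γ a positive integer, and let X₁, …, X_N ∈ [0, Γ(∏_{l=1}^{⌈L/N⌉} M_l − 1)) be real numbers. Assume noisy residues r̃_{il} = ⟨X_i + Δ_{il}⟩_{Γ M_l} are given with |Δ_{il}| < Γ/4 for all i, l, grouped into unordered sets R_l = {r̃_{il} : i}. Then there exist estimates X̂₁, …, X̂_N (computable from the R_l alone, without knowledge of the correspondence) such that, after a suitable permutation, |X̂_i − X_i| < 3Γ/4 for every i. -/

import Mathlib

/-- Generalized modulo operation for real numbers: `⟨a⟩_b = a - ⌊a/b⌋·b`. -/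
noncomputable def rmod (a b : ℝ) : ℝ := a - (⌊a / b⌋ : ℤ) * b



def gG {N : ℕ} (X Y : Fin N → ℤ) (s : ℤ) : ℤ :=
  ∑ i, ((if X i < s then 1 else 0) - (if Y i ≤ s then 1 else 0))

def hH {N : ℕ} (Q : ℤ) (X Y : Fin N → ℤ) (t : ℤ) : ℤ :=
  ∑ i, ((if X i ≤ t - Q then 1 else 0) - (if Y i < t then 1 else 0))

def aA {N : ℕ} (Q : ℤ) (X Y : Fin N → ℤ) (s : ℤ) : ℤ :=
  ∑ i, ((Y i - s - 1) / Q - (X i - s) / Q)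

structure Cfg (N L : ℕ) (Q P : ℤ) (κ : ℕ) (M : Fin L → ℤ) (X Y : Fin N → ℤ) : Prop where
  hN : 0 < N
  hNL : N ≤ L
  hL : κ * N + 1 ≤ L
  hQ : 2 ≤ Q
  hM : ∀ l, 0 < M l
  rXX : ∀ i j, X i - X j < (P - 1) * Q
  rYY : ∀ i j, Y i - Y j < (P - 1) * Q
  rXY : ∀ i j, X i - Y j < (P - 1) * Q
  rYX : ∀ i j, Y i - X j < P * Q
  dXX : ∀ i j k, X i = X j + Q * k → i = j
  dYY : ∀ i j k, Y i = Y j + Q * k → i = j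
  dXY : ∀ i j k, X i ≠ Y j + Q * k
  edge : ∀ l, ∃ π : Equiv.Perm (Fin N), ∀ i, ∃ n, M l ∣ n ∧ X i < Y (π i) + Q * n ∧
    Y (π i) + Q * n < X i + Q
  c1 : ∀ m : ℤ, m ≠ 0 → |m| < P → (Finset.univ.filter (fun l => M l ∣ m)).card ≤ κ
  c2 : (Finset.univ.filter (fun l => M l ∣ P)).card ≤ κ + 1

lemma cnt (W z R : ℤ) (hW : 0 < W) (h1 : -R ≤ z / W) (h2 : z / W ≤ R) :
    ∑ k ∈ Finset.Ioc (-R) R, (if z < W * k then (1:ℤ) else 0) = R - z / W := by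
  rw [Finset.sum_ite, Finset.sum_const_zero, add_zero, Finset.sum_const]
  have : (Finset.Ioc (-R) R).filter (fun k => z < W * k) = Finset.Ioc (z / W) R := by
    ext k
    simp only [Finset.mem_filter, Finset.mem_Ioc]
    have : z / W < k ↔ z < W * k := by rw [Int.ediv_lt_iff_lt_mul hW, mul_comm]
    rw [this]
    constructor
    · rintro ⟨⟨_, h⟩, h'⟩; exact ⟨h', h⟩
    · rintro ⟨h', h⟩; refine ⟨⟨?_, h⟩, h'⟩
      have := this.2 h'; omega
  rw [this, Int.card_Ioc]
  simp; omega

lemma div_bd (W z B : ℤ) (hW : 0 < W) (h : |z| ≤ B) : -B ≤ z / W ∧ z / W ≤ B := by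
  have := abs_le.1 h
  constructor
  · rw [Int.le_ediv_iff_mul_le hW]; nlinarith
  · apply Int.ediv_le_of_le_mul hW; nlinarith

lemma sumD {N : ℕ} (Q W s t : ℤ) (hQ : 0 < Q) (hW : 0 < W) (X Y : Fin N → ℤ) :
    ∃ R0 : ℤ, ∀ R, R0 ≤ R → ∑ k ∈ Finset.Ioc (-R) R, (gG X Y (s + W * k) - hH Q X Y (t + W * k)) =
      ∑ i, (-((X i - s) / W) + (Y i - s - 1) / W + (X i + Q - 1 - t) / W - (Y i - t) / W) := by
  refine ⟨∑ i, (|X i| + |Y i|) + |s| + |t| + Q + 1, fun R hR => ?_⟩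
  have hb : ∀ i, |X i| + |Y i| ≤ ∑ i, (|X i| + |Y i|) := fun i =>
    Finset.single_le_sum (f := fun i => |X i| + |Y i|) (fun j _ => by positivity) (Finset.mem_univ i)
  unfold gG hH
  simp_rw [← Finset.sum_sub_distrib]
  rw [Finset.sum_comm]
  refine Finset.sum_congr rfl fun i _ => ?_
  have hb := hb i
  simp only [Finset.sum_sub_distrib]
  have b : ∀ z : ℤ, |z| ≤ R → ∑ k ∈ Finset.Ioc (-R) R, (if z < W * k then (1:ℤ) else 0) = R - z / W :=
    fun z hz => cnt W z R hW (div_bd W z R hW hz).1 (div_bd W z R hW hz).2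
  have e1 := b (X i - s) (by rw [abs_le]; cases abs_cases (X i) <;> cases abs_cases (Y i) <;> cases abs_cases s <;> cases abs_cases t <;> constructor <;> omega)
  have e2 := b (Y i - s - 1) (by rw [abs_le]; cases abs_cases (X i) <;> cases abs_cases (Y i) <;> cases abs_cases s <;> cases abs_cases t <;> constructor <;> omega)
  have e3 := b (X i + Q - 1 - t) (by rw [abs_le]; cases abs_cases (X i) <;> cases abs_cases (Y i) <;> cases abs_cases s <;> cases abs_cases t <;> constructor <;> omega)
  have e4 := b (Y i - t) (by rw [abs_le]; cases abs_cases (X i) <;> cases abs_cases (Y i) <;> cases abs_cases s <;> cases abs_cases t <;> constructor <;> omega)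
  have f1 : ∀ k, (X i < s + W * k) = (X i - s < W * k) := fun k => by apply propext; constructor <;> intro <;> omega
  have f2 : ∀ k, (Y i ≤ s + W * k) = (Y i - s - 1 < W * k) := fun k => by apply propext; constructor <;> intro <;> omega
  have f3 : ∀ k, (X i ≤ t + W * k - Q) = (X i + Q - 1 - t < W * k) := fun k => by apply propext; constructor <;> intro <;> omega
  have f4 : ∀ k, (Y i < t + W * k) = (Y i - t < W * k) := fun k => by apply propext; constructor <;> intro <;> omega
  simp only [f1, f2, f3, f4, e1, e2, e3, e4]
  ring

section
variable {N L : ℕ} {Q P : ℤ} {κ : ℕ} {M : Fin L → ℤ} {X Y : Fin N → ℤ}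

lemma lat (c : Cfg N L Q P κ M X Y) (l : Fin L) (s t : ℤ) (h0 : gG X Y s < hH Q X Y t) :
    ∃ m, m ≠ 0 ∧ M l ∣ m ∧ hH Q X Y (t + Q * m) < gG X Y (s + Q * m) := by
  have hQ : 0 < Q := by have := c.hQ; omega
  have hM := c.hM l
  have hW : 0 < Q * M l := mul_pos hQ hM
  obtain ⟨R0, hR⟩ := sumD Q (Q * M l) s t hQ hW X Y
  have h := hR (max R0 1) (le_max_left _ _)
  set R := max R0 1
  have hR1 : 1 ≤ R := le_max_right _ _
  obtain ⟨π, hπ⟩ := c.edge l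
  have hge : 0 ≤ ∑ i, (-((X i - s) / (Q * M l)) + (Y i - s - 1) / (Q * M l) + (X i + Q - 1 - t) / (Q * M l) - (Y i - t) / (Q * M l)) := by
    have : ∑ i, (-((X i - s) / (Q * M l)) + (Y i - s - 1) / (Q * M l) + (X i + Q - 1 - t) / (Q * M l) - (Y i - t) / (Q * M l))
      = ∑ i, (-((X i - s) / (Q * M l)) + (X i + Q - 1 - t) / (Q * M l)) + ∑ i, ((Y (π i) - s - 1) / (Q * M l) - (Y (π i) - t) / (Q * M l)) := by
      rw [Equiv.sum_comp π (fun j => ((Y j - s - 1) / (Q * M l) - (Y j - t) / (Q * M l))), ← Finset.sum_add_distrib]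
      exact Finset.sum_congr rfl fun i _ => by ring
    rw [this, ← Finset.sum_add_distrib]
    refine Finset.sum_nonneg fun i _ => ?_
    obtain ⟨n, ⟨n', rfl⟩, h1, h2⟩ := hπ i
    have a1 : (X i - s) / (Q * M l) ≤ (Y (π i) - s - 1 + (Q * M l) * n') / (Q * M l) :=
      Int.ediv_le_ediv hW (by nlinarith)
    have a2 : (Y (π i) - t + (Q * M l) * n') / (Q * M l) ≤ (X i + Q - 1 - t) / (Q * M l) :=
      Int.ediv_le_ediv hW (by nlinarith)
    rw [Int.add_mul_ediv_left _ _ hW.ne'] at a1 a2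
    linarith
  by_contra hcon
  push Not at hcon
  have : ∑ k ∈ Finset.Ioc (-R) R, (gG X Y (s + Q * M l * k) - hH Q X Y (t + Q * M l * k)) < 0 := by
    calc _ < ∑ k ∈ Finset.Ioc (-R) R, (0:ℤ) := by
          refine Finset.sum_lt_sum (fun k _ => ?_) ⟨0, by simp; omega, by simpa using h0⟩
          by_cases hk : k = 0
          · subst hk; simpa using h0.le
          · have := hcon (M l * k) (mul_ne_zero hM.ne' hk) (dvd_mul_right _ _)
            rw [← mul_assoc] at this; linarith
      _ = 0 := by simp
  linarith

lemma tot (c : Cfg N L Q P κ M X Y) (s t : ℤ) (hx : ∃ i k, X i = t + Q * k) :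
    ∃ R0 : ℤ, ∀ R, R0 ≤ R → ∑ k ∈ Finset.Ioc (-R) R, (gG X Y (s + Q * k) - hH Q X Y (t + Q * k)) ≤ N - 1 + aA Q X Y s - aA Q X Y t := by
  have hQ : 0 < Q := by have := c.hQ; omega
  obtain ⟨R0, hR⟩ := sumD Q Q s t hQ hQ X Y
  refine ⟨R0, fun R h => ?_⟩
  rw [hR R h]
  have key : ∑ i, (-((X i - s) / Q) + (Y i - s - 1) / Q + (X i + Q - 1 - t) / Q - (Y i - t) / Q)
     = aA Q X Y s - aA Q X Y t + ∑ i, ((X i + Q - 1 - t) / Q - (Y i - t) / Q + ((Y i - t - 1) / Q - (X i - t) / Q)) := by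
    unfold aA
    rw [← Finset.sum_sub_distrib, ← Finset.sum_add_distrib]
    exact Finset.sum_congr rfl fun i _ => by ring
  have e : ∀ i, (X i + Q - 1 - t) / Q = (X i - t - 1) / Q + 1 := fun i => by
    rw [show X i + Q - 1 - t = X i - t - 1 + Q * 1 by ring, Int.add_mul_ediv_left _ _ hQ.ne']
  have : ∑ i, ((X i + Q - 1 - t) / Q - (Y i - t) / Q + ((Y i - t - 1) / Q - (X i - t) / Q)) < ∑ i : Fin N, (1:ℤ) := by
    obtain ⟨i, k, hi⟩ := hx
    refine Finset.sum_lt_sum (fun j _ => ?_) ⟨i, Finset.mem_univ i, ?_⟩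
    · rw [e]
      have := Int.ediv_le_ediv hQ (show Y j - t - 1 ≤ Y j - t by omega)
      have := Int.ediv_le_ediv hQ (show X j - t - 1 ≤ X j - t by omega)
      omega
    · rw [e]
      have := Int.ediv_le_ediv hQ (show Y i - t - 1 ≤ Y i - t by omega)
      have h3 : (X i - t - 1) / Q < (X i - t) / Q := by
        rw [Int.ediv_lt_iff_lt_mul hQ, hi]
        rw [show t + Q * k - t = Q * k by ring, Int.mul_ediv_cancel_left _ hQ.ne']
        nlinarith
      omega
  simp at this
  linarith

end

section
variable {N L : ℕ} {Q P : ℤ} {κ : ℕ} {M : Fin L → ℤ} {X Y : Fin N → ℤ}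

lemma g_pos {s : ℤ} (h : 1 ≤ gG X Y s) : (∃ i, X i < s) ∧ ∃ j, s < Y j := by
  constructor
  · by_contra hc; push Not at hc
    have : gG X Y s ≤ 0 := Finset.sum_nonpos fun i _ => by have := hc i; split_ifs <;> omega
    omega
  · by_contra hc; push Not at hc
    have : gG X Y s ≤ 0 := Finset.sum_nonpos fun i _ => by have := hc i; split_ifs <;> omega
    omega

lemma g_neg {s : ℤ} (h : gG X Y s ≤ -1) : (∃ i, Y i ≤ s) ∧ ∃ j, s ≤ X j := by
  constructor
  · by_contra hc; push Not at hc
    have : 0 ≤ gG X Y s := Finset.sum_nonneg fun i _ => by have := hc i; split_ifs <;> omega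
    omega
  · by_contra hc; push Not at hc
    have : 0 ≤ gG X Y s := Finset.sum_nonneg fun i _ => by have := hc i; split_ifs <;> omega
    omega

lemma h_pos {t : ℤ} (h : 1 ≤ hH Q X Y t) : (∃ i, X i ≤ t - Q) ∧ ∃ j, t ≤ Y j := by
  constructor
  · by_contra hc; push Not at hc
    have : hH Q X Y t ≤ 0 := Finset.sum_nonpos fun i _ => by have := hc i; split_ifs <;> omega
    omega
  · by_contra hc; push Not at hc
    have : hH Q X Y t ≤ 0 := Finset.sum_nonpos fun i _ => by have := hc i; split_ifs <;> omega
    omega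

lemma h_neg {t : ℤ} (h : hH Q X Y t ≤ -1) : (∃ i, Y i < t) ∧ ∃ j, t - Q < X j := by
  constructor
  · by_contra hc; push Not at hc
    have : 0 ≤ hH Q X Y t := Finset.sum_nonneg fun i _ => by have := hc i; split_ifs <;> omega
    omega
  · by_contra hc; push Not at hc
    have : 0 ≤ hH Q X Y t := Finset.sum_nonneg fun i _ => by have := hc i; split_ifs <;> omega
    omega

lemma h_step0 {u : ℤ} (h : ∀ i, X i ≠ u + 1 - Q) : hH Q X Y (u + 1) ≤ hH Q X Y u :=
  Finset.sum_le_sum fun i _ => by have := h i; split_ifs <;> omega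

lemma h_step1 (c : Cfg N L Q P κ M X Y) (u : ℤ) : hH Q X Y (u + 1) ≤ hH Q X Y u + 1 := by
  by_cases h : ∃ i, X i = u + 1 - Q
  · obtain ⟨i, hi⟩ := h
    have : ∀ j, j ≠ i → X j ≠ u + 1 - Q := fun j hj h => hj (c.dXX j i 0 (by rw [h, hi]; ring))
    have e : (∑ j, (if j = i then (1:ℤ) else 0)) = 1 := by simp
    calc _ ≤ ∑ j, (((if X j ≤ u - Q then (1:ℤ) else 0) - (if Y j < u then 1 else 0)) + if j = i then 1 else 0) := by
          refine Finset.sum_le_sum fun j _ => ?_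
          by_cases hj : j = i
          · subst hj; simp only [if_true]; split_ifs <;> omega
          · have := this j hj; rw [if_neg hj]; split_ifs <;> omega
      _ = _ := by rw [Finset.sum_add_distrib, e]; rfl
  · push Not at h
    have := h_step0 (X := X) (Y := Y) (Q := Q) (u := u) h
    omega

lemma h_start (hQ : 2 ≤ Q) (u : ℤ) : hH Q X Y (u + 1) ≤ gG X Y u :=
  Finset.sum_le_sum fun i _ => by split_ifs <;> omega

lemma h_le_g (hQ : 2 ≤ Q) (u : ℤ) (h : ∀ j, Y j ≠ u) : hH Q X Y u ≤ gG X Y u :=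
  Finset.sum_le_sum fun i _ => by have := h i; split_ifs <;> omega

lemma g_refl (s : ℤ) : gG (fun i => - Y i) (fun i => - X i) s = gG X Y (-s) :=
  Finset.sum_congr rfl fun i _ => by dsimp only; split_ifs <;> omega

lemma h_refl (t : ℤ) : hH Q (fun i => - Y i) (fun i => - X i) t = hH Q X Y (Q - t) :=
  Finset.sum_congr rfl fun i _ => by dsimp only; split_ifs <;> omega

lemma my_neg_div (Q z : ℤ) (hQ : 0 < Q) : (-z - 1) / Q = - (z / Q) - 1 := by
  have h1 := Int.emod_add_mul_ediv z Q
  have h2 := Int.emod_nonneg z hQ.ne'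
  have h3 := Int.emod_lt_of_pos z hQ
  refine Int.ediv_eq_iff_of_pos hQ |>.2 ⟨?_, ?_⟩ <;> nlinarith

lemma a_refl (hQ : 0 < Q) (s : ℤ) : aA Q (fun i => - Y i) (fun i => - X i) s = aA Q X Y (-s) := by
  refine Finset.sum_congr rfl fun i _ => ?_
  dsimp only
  have e1 := my_neg_div Q (X i + s) hQ
  have e2 := my_neg_div Q (Y i + s - 1) hQ
  rw [show - X i - s - 1 = -(X i + s) - 1 by ring, e1, show - Y i - s = -(Y i + s - 1) - 1 by ring, e2,
    show Y i - -s - 1 = Y i + s - 1 by ring, show X i - -s = X i + s by ring]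
  ring

lemma g_swap (s : ℤ) : gG Y (fun i => X i + Q) s = - hH Q X Y s := by
  unfold gG hH; rw [← Finset.sum_neg_distrib]
  exact Finset.sum_congr rfl fun i _ => by dsimp only; split_ifs <;> omega

lemma h_swap (s : ℤ) : hH Q Y (fun i => X i + Q) s = - gG X Y (s - Q) := by
  unfold gG hH; rw [← Finset.sum_neg_distrib]
  exact Finset.sum_congr rfl fun i _ => by dsimp only; split_ifs <;> omega

lemma Cfg.reflect (c : Cfg N L Q P κ M X Y) : Cfg N L Q P κ M (fun i => - Y i) (fun i => - X i) where
  hN := c.hN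
  hNL := c.hNL
  hL := c.hL
  hQ := c.hQ
  hM := c.hM
  rXX i j := by have := c.rYY j i; linarith
  rYY i j := by have := c.rXX j i; linarith
  rXY i j := by have := c.rXY j i; linarith
  rYX i j := by have := c.rYX j i; linarith
  dXX i j k h := c.dYY i j (-k) (by linarith)
  dYY i j k h := c.dXX i j (-k) (by linarith)
  dXY i j k h := c.dXY j i k (by linarith)
  edge l := by
    obtain ⟨π, hπ⟩ := c.edge l
    refine ⟨π.symm, fun i => ?_⟩
    obtain ⟨n, h, h1, h2⟩ := hπ (π.symm i)
    rw [Equiv.apply_symm_apply] at h1 h2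
    exact ⟨n, h, by linarith, by linarith⟩
  c1 := c.c1
  c2 := c.c2

lemma Cfg.swap (c : Cfg N L Q P κ M X Y) : Cfg N L Q P κ M Y (fun i => X i + Q) where
  hN := c.hN
  hNL := c.hNL
  hL := c.hL
  hQ := c.hQ
  hM := c.hM
  rXX := c.rYY
  rYY i j := by have := c.rXX i j; linarith
  rXY i j := by have := c.rYX i j; linarith
  rYX i j := by have := c.rXY i j; linarith
  dXX := c.dYY
  dYY i j k h := c.dXX i j k (by linarith)
  dXY i j k h := c.dXY j i (-k - 1) (by linarith)
  edge l := by
    obtain ⟨π, hπ⟩ := c.edge l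
    refine ⟨π.symm, fun i => ?_⟩
    obtain ⟨n, h, h1, h2⟩ := hπ (π.symm i)
    rw [Equiv.apply_symm_apply] at h1 h2
    exact ⟨-n, (dvd_neg).2 h, by linarith, by linarith⟩
  c1 := c.c1
  c2 := c.c2

end

section
variable {N L : ℕ} {Q P : ℤ} {κ : ℕ} {M : Fin L → ℤ} {X Y : Fin N → ℤ}

lemma a_per (hQ : 0 < Q) (s n : ℤ) : aA Q X Y (s + Q * n) = aA Q X Y s := by
  refine Finset.sum_congr rfl fun i _ => ?_
  rw [show Y i - (s + Q * n) - 1 = Y i - s - 1 + Q * (-n) by ring, Int.add_mul_ediv_left _ _ hQ.ne',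
    show X i - (s + Q * n) = X i - s + Q * (-n) by ring, Int.add_mul_ediv_left _ _ hQ.ne']
  ring

lemma lo_bd (f : Fin N → ℤ) : ∃ B, 0 ≤ B ∧ ∀ i, |f i| ≤ B :=
  ⟨∑ i, |f i|, Finset.sum_nonneg fun _ _ => abs_nonneg _, fun i =>
    Finset.single_le_sum (f := fun i => |f i|) (fun j _ => abs_nonneg _) (Finset.mem_univ i)⟩

lemma up1 (c : Cfg N L Q P κ M X Y) (σ : ℤ) (hv : (∃ t, 1 ≤ hH Q X Y t) ∨ gG X Y σ ≤ -1) :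
    ∃ s t, (∃ n, s = σ + Q * n) ∧ s < t ∧ gG X Y s = hH Q X Y t - 1 ∧ (∃ i, X i = t - Q) ∧
      (∀ m, m ≠ 0 → hH Q X Y (t + Q * m) ≤ gG X Y (s + Q * m)) ∧
      (∀ s' t', (∃ n, s' = σ + Q * n) → 0 < t' - s' → t' - s' < t - s → hH Q X Y t' ≤ gG X Y s') := by
  classical
  have hQ := c.hQ
  obtain ⟨B, hB0, hB⟩ := lo_bd X
  have hex : ∃ T : ℕ, ∃ n : ℤ, gG X Y (σ + Q * n) < hH Q X Y (σ + Q * n + (T + 1)) := by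
    rcases hv with ⟨t, ht⟩ | hg
    · have hn : σ + Q * (-(|σ| + B + |t| + 1)) ≤ -B - 1 ∧ σ + Q * (-(|σ| + B + |t| + 1)) < t - 1 := by
        have := neg_abs_le t
        have := le_abs_self σ
        have := abs_nonneg t
        have := abs_nonneg σ
        constructor <;> nlinarith
      set n := (-(|σ| + B + |t| + 1))
      have hg : gG X Y (σ + Q * n) ≤ 0 := by
        by_contra hc
        obtain ⟨⟨i, hi⟩, _⟩ := g_pos (X := X) (Y := Y) (s := σ + Q * n) (by omega)
        have := neg_le_of_abs_le (hB i)
        omega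
      refine ⟨(t - (σ + Q * n) - 1).toNat, n, ?_⟩
      rw [Int.toNat_of_nonneg (by omega)]
      rw [show σ + Q * n + (t - (σ + Q * n) - 1 + 1) = t by ring]
      omega
    · obtain ⟨B', hB0', hB'⟩ := lo_bd Y
      refine ⟨(B + B' + Q + |σ|).toNat, 0, ?_⟩
      have a1 := neg_abs_le σ
      have a2 := abs_nonneg σ
      rw [Int.toNat_of_nonneg (by omega)]
      by_contra hc
      obtain ⟨_, ⟨j, hj⟩⟩ := h_neg (Q := Q) (X := X) (Y := Y) (t := σ + Q * 0 + (B + B' + Q + |σ| + 1)) (by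
        simp only [mul_zero, add_zero] at hc ⊢; omega)
      have := le_of_abs_le (hB j)
      omega
  set T := Nat.find hex with hT
  obtain ⟨n, hn⟩ := Nat.find_spec hex
  rw [← hT] at hn
  have hmin : ∀ T' : ℕ, T' < T → ∀ n : ℤ, hH Q X Y (σ + Q * n + (T' + 1)) ≤ gG X Y (σ + Q * n) := by
    intro T' h n'
    have := Nat.find_min hex h
    push Not at this
    exact this n'
  have hT0 : 0 < T := by
    rcases Nat.eq_zero_or_pos T with h | h
    · rw [h] at hn
      have := h_start (X := X) (Y := Y) hQ (σ + Q * n)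
      simp at hn; omega
    · exact h
  obtain ⟨T', hT'⟩ : ∃ T', T = T' + 1 := ⟨T - 1, by omega⟩
  have hpre := hmin T' (by omega)
  rw [hT'] at hn
  push_cast at hn
  have hx : ∃ i, X i = σ + Q * n + (T' + 1) + 1 - Q := by
    by_contra hc; push Not at hc
    have := h_step0 (X := X) (Y := Y) (Q := Q) (u := σ + Q * n + (T' + 1)) hc
    have := hpre n
    rw [← add_assoc (σ + Q * n)] at hn; omega
  refine ⟨σ + Q * n, σ + Q * n + (T' + 1) + 1, ⟨n, rfl⟩, by omega, ?_, ?_, ?_, ?_⟩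
  · have := h_step1 c (σ + Q * n + (T' + 1))
    have := hpre n
    rw [← add_assoc (σ + Q * n)] at hn
    omega
  · exact hx
  · intro m hm
    have h0 := h_step0 (X := X) (Y := Y) (Q := Q) (u := σ + Q * (n + m) + (T' + 1)) (by
      intro j hj
      obtain ⟨i, hi⟩ := hx
      have : i = j := c.dXX i j (-m) (by rw [hi, hj]; ring)
      subst this
      have : Q * m = 0 := by linarith
      rcases mul_eq_zero.1 this with h | h <;> omega)
    have := hpre (n + m)
    rw [show σ + Q * n + (↑T' + 1) + 1 + Q * m = σ + Q * (n + m) + (T' + 1) + 1 by ring,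
      show σ + Q * n + Q * m = σ + Q * (n + m) by ring]
    omega
  · rintro s' t' ⟨n', rfl⟩ h1 h2
    have := hmin (t' - (σ + Q * n') - 1).toNat (by omega) n'
    rw [Int.toNat_of_nonneg (by omega), show σ + Q * n' + (t' - (σ + Q * n') - 1 + 1) = t' by ring] at this
    exact this

lemma up2 (c : Cfg N L Q P κ M X Y) (s t : ℤ) (hst : s < t) (h0 : gG X Y s = hH Q X Y t - 1)
    (hx : ∃ i, X i = t - Q) (hf : 0 < t - (s + Q) → hH Q X Y t ≤ gG X Y (s + Q)) (m : ℤ)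
    (hm : hH Q X Y (t + Q * m) < gG X Y (s + Q * m)) :
    |m| < P ∨ (m = P ∧ (∀ i, s < X i) ∧ (∃ i, X i ≤ s + Q) ∧ (∃ j, s + P * Q < Y j) ∧ 1 ≤ hH Q X Y t) := by
  have hQ := c.hQ
  have key : ∀ a b : ℤ, a * Q < Q * b → a < b := fun a b h => by
    by_contra hc; push Not at hc; nlinarith
  have key2 : ∀ a b : ℤ, Q * b < a * Q → b < a := fun a b h => by
    by_contra hc; push Not at hc; nlinarith
  by_cases hneg : hH Q X Y (t + Q * m) ≤ -1
  · left
    obtain ⟨⟨a, ha⟩, ⟨b, hb⟩⟩ := h_neg hneg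
    obtain ⟨k, hk⟩ := hx
    have r1 := c.rXY k a
    have r2 := c.rXX b k
    rw [abs_lt]
    exact ⟨key _ _ (by nlinarith), key2 _ _ (by nlinarith)⟩
  obtain ⟨⟨a, ha⟩, ⟨b, hb⟩⟩ := g_pos (X := X) (Y := Y) (s := s + Q * m) (by omega)
  by_cases hg : gG X Y s ≤ -1
  · left
    obtain ⟨⟨i, hi⟩, ⟨j, hj⟩⟩ := g_neg hg
    have r1 := c.rXX j a
    have r2 := c.rYY b i
    rw [abs_lt]
    exact ⟨key _ _ (by nlinarith), key2 _ _ (by nlinarith)⟩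
  have hh : 1 ≤ hH Q X Y t := by omega
  obtain ⟨_, ⟨j, hj⟩⟩ := h_pos hh
  have r1 := c.rYX j a
  have hlow : -P < m := key _ _ (by nlinarith)
  by_cases hxs : ∃ i, X i ≤ s
  · left
    obtain ⟨i, hi⟩ := hxs
    have r2 := c.rYX b i
    rw [abs_lt]
    exact ⟨hlow, key2 _ _ (by nlinarith)⟩
  push Not at hxs
  have hx2 : ∃ i, X i ≤ s + Q := by
    by_contra hc; push Not at hc
    obtain ⟨k, hk⟩ := hx
    have h1 := hf (by have := hc k; omega)
    obtain ⟨⟨i, hi⟩, _⟩ := g_pos (X := X) (Y := Y) (s := s + Q) (by omega)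
    have := hc i; omega
  obtain ⟨i, hi⟩ := hx2
  have r2 := c.rYX b i
  have hup : m < P + 1 := key2 _ _ (by nlinarith)
  by_cases hmP : m = P
  · right
    subst hmP
    exact ⟨rfl, hxs, ⟨i, hi⟩, ⟨b, by nlinarith⟩, hh⟩
  · left; rw [abs_lt]; omega

lemma cover (c : Cfg N L Q P κ M X Y) (T : Finset ℤ) (hcard : T.card ≤ N) (hT : ∀ m ∈ T, m ≠ 0 ∧ (|m| < P ∨ m = P))
    (hc : ∀ l, ∃ m ∈ T, M l ∣ m) : L ≤ κ * T.card + 1 ∧ P ∈ T := by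
  classical
  have hsub : (Finset.univ : Finset (Fin L)) ⊆ T.biUnion (fun m => Finset.univ.filter (fun l => M l ∣ m)) := by
    intro l _
    obtain ⟨m, hm, hl⟩ := hc l
    simp only [Finset.mem_biUnion, Finset.mem_filter, Finset.mem_univ, true_and]
    exact ⟨m, hm, hl⟩
  have h1 := (Finset.card_le_card hsub).trans Finset.card_biUnion_le
  rw [Finset.card_univ, Fintype.card_fin] at h1
  have hle : ∀ m ∈ T, m ≠ P → (Finset.univ.filter (fun l => M l ∣ m)).card ≤ κ := fun m hm hP =>
    c.c1 m (hT m hm).1 ((hT m hm).2.resolve_right hP)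
  constructor
  · have : ∑ m ∈ T, (Finset.univ.filter (fun l => M l ∣ m)).card ≤ ∑ m ∈ T, (κ + if m = P then 1 else 0) := by
      refine Finset.sum_le_sum fun m hm => ?_
      by_cases h : m = P
      · subst h; simpa using c.c2
      · simpa [h] using hle m hm h
    rw [Finset.sum_add_distrib, Finset.sum_const, smul_eq_mul, Finset.sum_ite_eq'] at this
    split_ifs at this <;> nlinarith
  · by_contra hP
    have : ∑ m ∈ T, (Finset.univ.filter (fun l => M l ∣ m)).card ≤ ∑ m ∈ T, κ :=
      Finset.sum_le_sum fun m hm => hle m hm (fun h => hP (h ▸ hm))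
    rw [Finset.sum_const, smul_eq_mul] at this
    have := c.hL
    nlinarith

lemma up (c : Cfg N L Q P κ M X Y) (σ : ℤ) (hσ : ∀ t, aA Q X Y σ ≤ aA Q X Y t)
    (hv : (∃ t, 1 ≤ hH Q X Y t) ∨ gG X Y σ ≤ -1) :
    ∃ s t, (∃ n, s = σ + Q * n) ∧ (∀ i, s < X i) ∧ (∃ i, X i ≤ s + Q) ∧ (∃ j, s + P * Q < Y j) ∧
      1 ≤ hH Q X Y t ∧ (∃ i, X i = t - Q) ∧ aA Q X Y t ≤ aA Q X Y σ ∧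
      (∀ m, gG X Y (s + Q * m) - hH Q X Y (t + Q * m) ≤ 1) ∧ gG X Y (s + Q) ≤ hH Q X Y (t + Q) ∧
      (∀ s' t', (∃ n, s' = σ + Q * n) → 0 < t' - s' → t' - s' < t - s → hH Q X Y t' ≤ gG X Y s') := by
  classical
  obtain ⟨s, t, ⟨n, hs⟩, hst, h0, hx, hD, hfirst⟩ := up1 c σ hv
  have hQ := c.hQ
  have hr := up2 c s t hst h0 hx (fun h => hfirst _ _ ⟨n + 1, by rw [hs]; ring⟩ h (by omega))
  obtain ⟨R0, hR⟩ := tot c s t (by obtain ⟨i, hi⟩ := hx; exact ⟨i, -1, by rw [hi]; ring⟩)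
  have hP2 : 2 ≤ P := by
    obtain ⟨i, _⟩ := hx
    have := c.rXX i i
    by_contra hc
    nlinarith
  have has : aA Q X Y s = aA Q X Y σ := by rw [hs, a_per (by omega)]
  have hat := hσ t
  set R := max R0 (P + 1) with hRdef
  have hRP : P + 1 ≤ R := le_max_right _ _
  have hsum := hR R (le_max_left _ _)
  set S := (Finset.Ioc (-R) R).filter (fun m => m ≠ 0 ∧ hH Q X Y (t + Q * m) < gG X Y (s + Q * m)) with hS
  have hmemS : ∀ m, m ≠ 0 → hH Q X Y (t + Q * m) < gG X Y (s + Q * m) → m ∈ S := by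
    intro m hm h
    rw [hS, Finset.mem_filter, Finset.mem_Ioc]
    refine ⟨?_, hm, h⟩
    rcases hr m h with h | h
    · rw [abs_lt] at h; omega
    · omega
  have hSr : ∀ m ∈ S, m ≠ 0 ∧ (|m| < P ∨ m = P) := by
    intro m hm
    rw [hS, Finset.mem_filter] at hm
    refine ⟨hm.2.1, ?_⟩
    rcases hr m hm.2.2 with h | h
    · exact Or.inl h
    · exact Or.inr h.1
  have hcov : ∀ l, ∃ m ∈ S, M l ∣ m := by
    intro l
    obtain ⟨m, hm, hd, h⟩ := lat c l s t (by omega)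
    exact ⟨m, hmemS m hm h, hd⟩
  have hsumS : ∑ m ∈ S, (gG X Y (s + Q * m) - hH Q X Y (t + Q * m)) ≤ N + aA Q X Y s - aA Q X Y t := by
    have h0mem : (0:ℤ) ∈ Finset.Ioc (-R) R := by rw [Finset.mem_Ioc]; omega
    rw [← Finset.add_sum_erase _ _ h0mem] at hsum
    simp only [mul_zero, add_zero] at hsum
    have : ∑ m ∈ S, (gG X Y (s + Q * m) - hH Q X Y (t + Q * m)) ≤
        ∑ m ∈ (Finset.Ioc (-R) R).erase 0, (gG X Y (s + Q * m) - hH Q X Y (t + Q * m)) := by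
      refine Finset.sum_le_sum_of_subset_of_nonneg ?_ ?_
      · intro m hm
        rw [hS, Finset.mem_filter] at hm
        exact Finset.mem_erase.2 ⟨hm.2.1, hm.1⟩
      · intro m hm _
        have := hD m (Finset.mem_erase.1 hm).1
        omega
    omega
  have hge1 : ∀ m ∈ S, 1 ≤ gG X Y (s + Q * m) - hH Q X Y (t + Q * m) := by
    intro m hm
    rw [hS, Finset.mem_filter] at hm
    omega
  have hcardS : (S.card : ℤ) ≤ N + aA Q X Y s - aA Q X Y t := by
    refine le_trans ?_ hsumS
    have := Finset.sum_le_sum hge1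
    simpa using this
  have hSN : S.card ≤ N := by omega
  obtain ⟨hLS, hPS⟩ := cover c S hSN hSr hcov
  have hNS : N ≤ S.card := by
    rcases Nat.eq_zero_or_pos κ with h | h
    · have := c.hNL
      have : 0 < S.card := Finset.card_pos.2 ⟨P, hPS⟩
      rw [h] at hLS; omega
    · have := c.hL
      by_contra hc
      have : κ * S.card + 1 ≤ κ * N := by nlinarith
      omega
  have h1S : (1:ℤ) ∉ S := by
    intro h1
    obtain ⟨hL', -⟩ := cover c (S.erase 1) ((Finset.card_erase_le).trans hSN)
      (fun m hm => hSr m (Finset.mem_of_mem_erase hm)) (by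
        intro l
        obtain ⟨m, hm, hd⟩ := hcov l
        by_cases h : m = 1
        · exact ⟨P, Finset.mem_erase.2 ⟨by omega, hPS⟩, (h ▸ hd).trans (one_dvd _)⟩
        · exact ⟨m, Finset.mem_erase.2 ⟨h, hm⟩, hd⟩)
    have hc1 : (S.erase 1).card + 1 = S.card := Finset.card_erase_add_one h1
    rcases Nat.eq_zero_or_pos κ with h | h
    · have := c.hNL
      have : 0 < (S.erase 1).card := Finset.card_pos.2 ⟨P, Finset.mem_erase.2 ⟨by omega, hPS⟩⟩
      rw [h] at hL'; omega
    · have := c.hL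
      have : κ * (S.erase 1).card + 1 ≤ κ * N := by nlinarith
      omega
  have hPd : hH Q X Y (t + Q * P) < gG X Y (s + Q * P) := by
    rw [hS, Finset.mem_filter] at hPS; exact hPS.2.2
  rcases hr P hPd with h | ⟨-, hq1, hq2, hq3, hq4⟩
  · rw [abs_lt] at h; omega
  refine ⟨s, t, ⟨n, hs⟩, hq1, hq2, hq3, hq4, hx, by omega, ?_, ?_, hfirst⟩
  · intro m
    by_cases hm : m ∈ S
    · by_contra hc
      have : ∑ m ∈ S, (1:ℤ) < ∑ m ∈ S, (gG X Y (s + Q * m) - hH Q X Y (t + Q * m)) :=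
        Finset.sum_lt_sum hge1 ⟨m, hm, by omega⟩
      simp only [Finset.sum_const, nsmul_eq_mul, mul_one] at this
      omega
    · by_cases hm0 : m = 0
      · subst hm0; simp only [mul_zero, add_zero]; omega
      · by_contra hc
        exact hm (hmemS m hm0 (by omega))
  · by_contra hc
    exact h1S (hmemS 1 one_ne_zero (by rw [mul_one]; omega))

end

section
variable {N L : ℕ} {Q P : ℤ} {κ : ℕ} {M : Fin L → ℤ} {X Y : Fin N → ℤ}

lemma shift_win (hQ : 0 < Q) (σ t0 : ℤ) : ∃ n, t0 ≤ σ + Q * n ∧ σ + Q * n < t0 + Q := by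
  have h1 := Int.emod_add_mul_ediv (σ - t0) Q
  have h2 := Int.emod_nonneg (σ - t0) hQ.ne'
  have h3 := Int.emod_lt_of_pos (σ - t0) hQ
  refine ⟨- ((σ - t0) / Q), ?_, ?_⟩ <;> linarith

lemma argmin_win (hQ : 0 < Q) (X Y : Fin N → ℤ) (t0 : ℤ) :
    ∃ σ, t0 ≤ σ ∧ σ < t0 + Q ∧ ∀ t, aA Q X Y σ ≤ aA Q X Y t := by
  obtain ⟨σ, hσ, hm⟩ := Finset.exists_min_image (Finset.Ico t0 (t0 + Q)) (aA Q X Y)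
    ⟨t0, by simp; omega⟩
  rw [Finset.mem_Ico] at hσ
  refine ⟨σ, hσ.1, hσ.2, fun t => ?_⟩
  obtain ⟨n, h1, h2⟩ := shift_win hQ t t0
  rw [← a_per hQ t n]
  exact hm _ (Finset.mem_Ico.2 ⟨h1, h2⟩)

lemma first_neg (s σ t : ℤ) (h1 : ∃ n, s = σ + Q * n) (h2 : ∀ i, s < X i) (hQ : 2 ≤ Q)
    (hf : ∀ s' t', (∃ n, s' = σ + Q * n) → 0 < t' - s' → t' - s' < t - s → hH Q X Y t' ≤ gG X Y s')
    (t' : ℤ) (ht : t' < t) : hH Q X Y t' ≤ 0 := by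
  by_contra hc
  obtain ⟨⟨i, hi⟩, _⟩ := h_pos (show 1 ≤ hH Q X Y t' by omega)
  have := h2 i
  have h3 := hf s t' h1 (by omega) (by omega)
  obtain ⟨⟨k, hk⟩, _⟩ := g_pos (show 1 ≤ gG X Y s by omega)
  have := h2 k
  omega

lemma tight (c : Cfg N L Q P κ M X Y) (σ : ℤ) (hσ : ∀ t, aA Q X Y σ ≤ aA Q X Y t)
    (hv : (∃ t, 1 ≤ hH Q X Y t) ∨ gG X Y σ ≤ -1) :
    ∃ s A : ℤ, 1 ≤ A ∧ (∀ i, s < X i) ∧ (∃ i, X i ≤ s + Q) ∧ (∃ j, s + P * Q < Y j) ∧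
      (∀ k, 1 ≤ k → k ≤ A → 1 ≤ gG X Y (s + Q * k)) ∧
      (∀ t, s + Q * A ≤ t → t ≤ s + Q * A + Q → 1 ≤ hH Q X Y t) := by
  have hQ := c.hQ
  obtain ⟨s1, t1, a1, b1, -, -, e1, f1, g1, -, -, k1⟩ := up c σ hσ hv
  have n1 := first_neg s1 σ t1 a1 b1 hQ k1
  have hm : ∀ t, aA Q X Y t1 ≤ aA Q X Y t := fun t => g1.trans (hσ t)
  obtain ⟨s, t, a, b, d, d', e, f, -, -, i, k⟩ := up c t1 hm (Or.inl ⟨t1, e1⟩)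
  have n2 := first_neg s t1 t a b hQ k
  have htt : t = t1 := by
    rcases lt_trichotomy t t1 with h | h | h
    · have := n1 t h; omega
    · exact h
    · have := n2 t1 h; omega
  subst htt
  obtain ⟨n, hn⟩ := a
  obtain ⟨i0, hi0⟩ := f
  have hYn : ∀ j, Y j ≠ t := fun j hj => c.dXY i0 j (-1) (by rw [hi0, hj]; ring)
  have hXn : ∀ j, X j ≠ t := fun j hj => by
    have := c.dXX j i0 1 (by rw [hi0, hj]; ring)
    subst this; omega
  have hG : ∀ k', 1 ≤ k' → k' ≤ -n → 1 ≤ gG X Y (s + Q * k') := by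
    intro k' h1 h2
    rcases eq_or_lt_of_le h2 with h | h
    · have : s + Q * k' = t := by rw [h, hn]; ring
      rw [this]; exact e.trans (h_le_g hQ t hYn)
    · refine e.trans (k _ _ ⟨n + k', by rw [hn]; ring⟩ ?_ ?_)
      · rw [hn]; nlinarith
      · nlinarith
  have hn1 : 1 ≤ -n := by
    have := b i0
    by_contra hc
    have : 0 ≤ Q * n := mul_nonneg (by omega) (by omega)
    omega
  have hQt : 1 ≤ hH Q X Y (t + Q) := by
    have := hG 1 le_rfl hn1
    rw [mul_one] at this; exact this.trans i
  have hg1 : gG X Y t ≤ 1 := by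
    obtain ⟨s', t', ⟨n', a'⟩, b', -, -, -, ⟨i', f'⟩, -, g', -, -⟩ := up c.reflect (-t)
      (fun u => by rw [a_refl (by omega), a_refl (by omega), neg_neg]; exact hm _)
      (Or.inl ⟨Q - t, by rw [h_refl, sub_sub_cancel]; exact e⟩)
    have h1 := g' (-n')
    rw [g_refl, h_refl] at h1
    have h2 := b' i'
    rw [show -(s' + Q * -n') = t by rw [a']; ring] at h1
    have h3 := n1 (Q - (t' + Q * -n')) (by
      have : Q * -n' = -(Q * n') := by ring
      omega)
    omega
  have hY : ∀ j, ¬ (t < Y j ∧ Y j < t + Q) := by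
    intro j hj
    have h1 : ∑ i, (if t < Y i ∧ Y i < t + Q then (1:ℤ) else 0) = gG X Y t - hH Q X Y (t + Q) := by
      unfold gG hH; rw [← Finset.sum_sub_distrib]
      refine Finset.sum_congr rfl fun i _ => ?_
      have := hXn i; have := hYn i
      split_ifs <;> omega
    have h2 := Finset.single_le_sum (f := fun i => if t < Y i ∧ Y i < t + Q then (1:ℤ) else 0)
      (fun i _ => by split_ifs <;> omega) (Finset.mem_univ j)
    simp only [hj, if_true, and_self] at h2
    omega
  refine ⟨s, -n, hn1, b, d, d', hG, ?_⟩
  rw [show s + Q * -n = t by rw [hn]; ring]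
  intro u h1 h2
  refine e.trans (Finset.sum_le_sum fun i _ => ?_)
  have := hY i; have := hYn i
  split_ifs <;> omega

lemma noH (c : Cfg N L Q P κ M X Y) (t : ℤ) : hH Q X Y t ≤ 0 := by
  by_contra hc
  have hQ := c.hQ
  obtain ⟨σ, -, -, hσ⟩ := argmin_win (show 0 < Q by omega) X Y 0
  obtain ⟨s, A, hA, h1, ⟨i1, h2⟩, ⟨j1, h3⟩, h4, h5⟩ := tight c σ hσ (Or.inl ⟨t, by omega⟩)
  obtain ⟨σ', w1, w2, hσ'⟩ := argmin_win (show 0 < Q by omega) Y (fun i => X i + Q) (s + Q * A)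
  have h6 := h5 σ' w1 (by omega)
  obtain ⟨s', A', hA', h1', ⟨i1', h2'⟩, ⟨j1', h3'⟩, h4', h5'⟩ := tight c.swap σ' hσ'
    (Or.inr (by rw [g_swap]; omega))
  simp only [g_swap, h_swap] at *
  have r1 := c.rYY j1 i1'
  have r2 := c.rXX j1' i1
  have e : (P - 1) * Q = P * Q - Q := by ring
  have l1 : s < s' := by omega
  have l2 : s' < s + Q := by omega
  rcases le_total A A' with h | h
  · have x1 := h5 (s' + Q * A) (by omega) (by omega)
    have x2 := h4' A hA h
    omega
  · have x1 := h4 A' hA' h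
    have x2 := h5' (s + Q * A' + Q) (by omega) (by omega)
    rw [add_sub_cancel_right] at x2
    omega

lemma noG (c : Cfg N L Q P κ M X Y) (s : ℤ) : 0 ≤ gG X Y s := by
  have := noH c.swap (s + Q)
  rw [h_swap, add_sub_cancel_right] at this
  omega

lemma sorted_ne (x y : Fin N → ℤ) (hx : Monotone x) (hy : Monotone y) (i : Fin N)
    (h : x i < y i) : ∑ j, ((if x j ≤ x i then (1:ℤ) else 0) - (if y j ≤ x i then 1 else 0)) ≥ 1 := by
  have e : (∑ j : Fin N, (if j = i then (1:ℤ) else 0)) = 1 := by simp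
  have : ∑ j, ((if j = i then (1:ℤ) else 0) + ((if j < i then (1:ℤ) else 0) - (if j < i then 1 else 0))) ≤
      ∑ j, ((if x j ≤ x i then (1:ℤ) else 0) - (if y j ≤ x i then 1 else 0)) := by
    refine Finset.sum_le_sum fun j _ => ?_
    rcases lt_trichotomy j i with h' | h' | h'
    · have := hx h'.le; have := h'.ne; split_ifs <;> omega
    · subst h'; have := hx (le_refl j); split_ifs <;> omega
    · have := hy h'.le; have := h'.ne'; have := hx h'.le; split_ifs <;> omega
  simp only [sub_self, add_zero, e] at this
  exact this

lemma match_sorted (c : Cfg N L Q P κ M X Y) : ∃ π : Equiv.Perm (Fin N), ∀ i, X i ≤ Y (π i) ∧ Y (π i) ≤ X i + Q := by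
  have hx := Tuple.monotone_sort X
  have hy := Tuple.monotone_sort Y
  set p := Tuple.sort X
  set q := Tuple.sort Y
  have main : ∀ i, X (p i) ≤ Y (q i) ∧ Y (q i) ≤ X (p i) + Q := by
    intro i
    constructor
    · by_contra hc; push Not at hc
      have h := sorted_ne (Y ∘ q) (X ∘ p) hy hx i hc
      have h2 := noG c (Y (q i))
      unfold gG at h2
      rw [Finset.sum_sub_distrib] at h h2
      rw [← Equiv.sum_comp p, ← Equiv.sum_comp q (fun j => if Y j ≤ Y (q i) then (1:ℤ) else 0)] at h2
      have h3 : ∑ j, (if X (p j) < Y (q i) then (1:ℤ) else 0) ≤ ∑ j, (if X (p j) ≤ Y (q i) then (1:ℤ) else 0) :=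
        Finset.sum_le_sum fun j _ => by split_ifs <;> omega
      simp only [Function.comp] at h
      omega
    · by_contra hc; push Not at hc
      have hx' : Monotone (fun j => X (p j) + Q) := fun a b hab => by
        have := hx hab; simp only [Function.comp] at this; dsimp only; omega
      have h := sorted_ne (fun j => X (p j) + Q) (Y ∘ q) hx' hy i hc
      have h2 := noH c (X (p i) + Q)
      unfold hH at h2
      rw [Finset.sum_sub_distrib] at h h2
      rw [← Equiv.sum_comp p, ← Equiv.sum_comp q (fun j => if Y j < X (p i) + Q then (1:ℤ) else 0)] at h2
      have h3 : ∑ j, (if Y (q j) < X (p i) + Q then (1:ℤ) else 0) ≤ ∑ j, (if Y (q j) ≤ X (p i) + Q then (1:ℤ) else 0) :=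
        Finset.sum_le_sum fun j _ => by split_ifs <;> omega
      have h4 : ∑ j, (if X (p j) ≤ X (p i) + Q - Q then (1:ℤ) else 0) = ∑ j, (if X (p j) + Q ≤ X (p i) + Q then (1:ℤ) else 0) :=
        Finset.sum_congr rfl fun j _ => by split_ifs <;> omega
      simp only [Function.comp] at h
      omega
  refine ⟨p.symm.trans q, fun i => ?_⟩
  have := main (p.symm i)
  simpa using this

end


lemma rank_lem (n : ℕ) (z : Fin n → ℝ) : ∃ (Q : ℤ) (w : Fin n → ℤ), 2 ≤ Q ∧
    (∀ i j (k : ℤ), z i < z j + k → w i < w j + k * Q) ∧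
    (∀ i j k, w i = w j + Q * k → i = j) := by
  have hm := Tuple.monotone_sort (fun i => Int.fract (z i))
  set σ := Tuple.sort (fun i => Int.fract (z i))
  have hρ : ∀ i, ((σ.symm i : Fin n) : ℤ) < n := fun i => by have := (σ.symm i).2; omega
  refine ⟨n + 2, fun i => (n + 2) * ⌊z i⌋ + ((σ.symm i : Fin n) : ℤ), by omega, ?_, ?_⟩
  · intro i j k h
    have h1 : ⌊z i⌋ ≤ ⌊z j⌋ + k := by
      rw [← Int.floor_add_intCast]; exact Int.floor_le_floor h.le
    dsimp only
    have := hρ i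
    rcases eq_or_lt_of_le h1 with h2 | h2
    · have h3 : σ.symm i < σ.symm j := by
        by_contra hc; push Not at hc
        have := hm hc
        simp only [Function.comp, Equiv.apply_symm_apply] at this
        unfold Int.fract at this
        rw [h2] at this; push_cast at this; linarith
      have h4 : ((σ.symm i : Fin n) : ℤ) < ((σ.symm j : Fin n) : ℤ) := by exact_mod_cast h3
      rw [h2]; linarith
    · nlinarith [show (0:ℤ) ≤ ((σ.symm j : Fin n) : ℤ) by positivity]
  · intro i j k h
    dsimp only at h
    have a := hρ i
    have b := hρ j
    have : ((σ.symm i : Fin n) : ℤ) = ((σ.symm j : Fin n) : ℤ) := by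
      have h1 : ((n:ℤ) + 2) ∣ ((σ.symm i : Fin n) : ℤ) - ((σ.symm j : Fin n) : ℤ) :=
        ⟨⌊z j⌋ + k - ⌊z i⌋, by linarith⟩
      have := Int.eq_zero_of_abs_lt_dvd h1 (by rw [abs_lt]; constructor <;> omega)
      omega
    exact σ.symm.injective (Fin.ext (by exact_mod_cast this))

lemma real_match {N L : ℕ} (hN : 0 < N) (hNL : N ≤ L) (κ : ℕ) (P : ℤ) (M : Fin L → ℤ) (hL : κ * N + 1 ≤ L)
    (hM : ∀ l, 0 < M l)
    (c1 : ∀ m : ℤ, m ≠ 0 → |m| < P → (Finset.univ.filter (fun l => M l ∣ m)).card ≤ κ)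
    (c2 : (Finset.univ.filter (fun l => M l ∣ P)).card ≤ κ + 1)
    (x y : Fin N → ℝ) (hx : ∀ i, 0 ≤ x i ∧ x i < P - 1) (hy : ∀ i, 0 ≤ y i ∧ y i < P - 1)
    (edge : ∀ l, ∃ π : Equiv.Perm (Fin N), ∀ i, ∃ n : ℤ, M l ∣ n ∧ |x i - y (π i) - n| < 1 / 2) :
    ∃ π : Equiv.Perm (Fin N), ∀ i, |x i - y (π i)| ≤ 1 / 2 := by
  obtain ⟨Q, w, hQ, hw, hd⟩ := rank_lem (N + N) (Fin.append x (fun i => y i + 1 / 2))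
  have hXX : ∀ i j (k : ℤ), x i < x j + k → w (Fin.castAdd N i) < w (Fin.castAdd N j) + k * Q := fun i j k h =>
    hw _ _ k (by simpa using h)
  have hYY : ∀ i j (k : ℤ), y i < y j + k → w (Fin.natAdd N i) < w (Fin.natAdd N j) + k * Q := fun i j k h =>
    hw _ _ k (by simp only [Fin.append_right]; linarith)
  have hXY : ∀ i j (k : ℤ), x i < y j + 1 / 2 + k → w (Fin.castAdd N i) < w (Fin.natAdd N j) + k * Q := fun i j k h =>
    hw _ _ k (by simp only [Fin.append_right, Fin.append_left]; linarith)
  have hYX : ∀ i j (k : ℤ), y i + 1 / 2 < x j + k → w (Fin.natAdd N i) < w (Fin.castAdd N j) + k * Q := fun i j k h =>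
    hw _ _ k (by simp only [Fin.append_right, Fin.append_left]; linarith)
  have cfg : Cfg N L Q P κ M (fun i => w (Fin.castAdd N i)) (fun i => w (Fin.natAdd N i)) :=
    { hN := hN, hNL := hNL, hL := hL, hQ := hQ, hM := hM, c1 := c1, c2 := c2
      rXX := fun i j => by
        have := hXX i j (P - 1) (by push_cast; linarith [hx i, hx j]); linarith
      rYY := fun i j => by
        have := hYY i j (P - 1) (by push_cast; linarith [hy i, hy j]); linarith
      rXY := fun i j => by
        have := hXY i j (P - 1) (by push_cast; linarith [hx i, hy j]); linarith
      rYX := fun i j => by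
        have := hYX i j P (by linarith [hy i, hx j]); linarith
      dXX := fun i j k h => Fin.castAdd_injective N N (hd _ _ k h)
      dYY := fun i j k h => Fin.natAdd_injective N N (hd _ _ k h)
      dXY := fun i j k h => by
        have := congrArg Fin.val (hd _ _ k h)
        simp at this; omega
      edge := fun l => by
        obtain ⟨π, hπ⟩ := edge l
        refine ⟨π, fun i => ?_⟩
        obtain ⟨n, h1, h2⟩ := hπ i
        rw [abs_lt] at h2
        refine ⟨n, h1, ?_, ?_⟩
        · have := hXY i (π i) n (by linarith); linarith
        · have := hYX (π i) i (1 - n) (by push_cast; linarith); linarith }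
  obtain ⟨π, hπ⟩ := match_sorted cfg
  refine ⟨π, fun i => ?_⟩
  obtain ⟨h1, h2⟩ := hπ i

  rw [abs_le]
  constructor
  · by_contra hc; push Not at hc
    have := hXY i (π i) (-1) 
    have := hw (Fin.castAdd N i) (Fin.natAdd N (π i)) (-1) (by simp only [Fin.append_right, Fin.append_left]; push_cast; linarith)
    linarith
  · by_contra hc; push Not at hc
    have := hYX (π i) i 0 (by push_cast; linarith)
    linarith

lemma perm_of_map {N : ℕ} (f g : Fin N → ℝ)
    (h : Multiset.map f Finset.univ.val = Multiset.map g Finset.univ.val) :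
    ∃ e : Equiv.Perm (Fin N), ∀ i, f i = g (e i) := by
  classical
  have hc : ∀ c, Nonempty ({a // f a = c} ≃ {b // g b = c}) := by
    intro c
    rw [← Fintype.card_eq, Fintype.card_subtype, Fintype.card_subtype]
    have := congrArg (Multiset.count c) h
    rw [Multiset.count_map, Multiset.count_map] at this
    simp only [Finset.card_def, Finset.filter_val, eq_comm (b := c)] at this ⊢
    simpa [eq_comm] using this
  exact ⟨Equiv.ofFiberEquiv (fun c => (hc c).some), fun i => (Equiv.ofFiberEquiv_map _ i).symm⟩

lemma filt_eq {L K : ℕ} (hKL : K ≤ L) :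
    (Finset.univ.filter (fun l : Fin L => (l : ℕ) < K)) = Finset.univ.map (Fin.castLEEmb hKL) := by
  ext l
  simp only [Finset.mem_filter, Finset.mem_univ, true_and, Finset.mem_map]
  constructor
  · intro h; exact ⟨⟨l, h⟩, rfl⟩
  · rintro ⟨k, rfl⟩; exact k.2

lemma emb_ge {L K : ℕ} (f : Fin K → Fin L) (hf : StrictMono f) (n : ℕ) :
    ∀ h : n < K, n ≤ (f ⟨n, h⟩ : ℕ) := by
  induction n with
  | zero => intro h; omega
  | succ n ih =>
    intro h
    have h1 := ih (by omega)
    have h2 : (f ⟨n, by omega⟩ : ℕ) < f ⟨n + 1, h⟩ := hf (by simp)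
    omega

lemma prod_min {L K : ℕ} (hKL : K ≤ L) (M : Fin L → ℕ) (hmono : Monotone M)
    (T : Finset (Fin L)) (hT : T.card = K) :
    ∏ l ∈ Finset.univ.filter (fun l : Fin L => (l : ℕ) < K), M l ≤ ∏ l ∈ T, M l := by
  rw [filt_eq hKL, Finset.prod_map]
  rw [← Finset.map_orderEmbOfFin_univ T hT, Finset.prod_map]
  refine Finset.prod_le_prod' fun k _ => hmono ?_
  have := emb_ge (T.orderEmbOfFin hT) (T.orderEmbOfFin hT).strictMono k k.2
  exact Fin.le_def.2 this

theorem stmt15 (L N : ℕ) (hN : 0 < N) (hNL : N ≤ L)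
    (Γ : ℕ) (hΓ : 0 < Γ)
    (M : Fin L → ℕ) (hMpos : ∀ l, 0 < M l)
    (hmono : ∀ l l' : Fin L, l < l' → M l < M l')
    (hcop : ∀ l l', l ≠ l' → Nat.Coprime (M l) (M l'))
    (K : ℕ) (hK : K = (L + N - 1) / N) :
    ∃ dec : (Fin L → Multiset ℝ) → (Fin N → ℝ),
      ∀ (X : Fin N → ℝ) (Δ : Fin N → Fin L → ℝ),
        (∀ i, X i ∈ Set.Ico (0 : ℝ)
          ((Γ : ℝ) * ((∏ l ∈ Finset.univ.filter (fun l : Fin L => (l : ℕ) < K), M l : ℕ) - 1))) →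
        (∀ i l, |Δ i l| < (Γ : ℝ) / 4) →
        ∃ σ : Equiv.Perm (Fin N),
          ∀ i, |dec (fun l => Multiset.map
                  (fun i' => rmod (X i' + Δ i' l) ((Γ : ℝ) * (M l : ℝ)))
                  Finset.univ.val) (σ i) - X i| < 3 * (Γ : ℝ) / 4 := by
  classical
  have hsm : StrictMono M := fun a b h => hmono a b h
  have hK1 : 1 ≤ K := by
    rw [hK, Nat.le_div_iff_mul_le hN]; omega
  have hKN : K * N ≤ L + N - 1 := by rw [hK]; exact Nat.div_mul_le_self _ _
  obtain ⟨κ, rfl⟩ : ∃ κ, K = κ + 1 := ⟨K - 1, by omega⟩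
  have hL : κ * N + 1 ≤ L := by rw [add_mul] at hKN; omega
  have hKL : κ + 1 ≤ L := by nlinarith
  set P := ∏ l ∈ Finset.univ.filter (fun l : Fin L => (l : ℕ) < κ + 1), M l with hP
  have hΓr : (0:ℝ) < Γ := by exact_mod_cast hΓ
  have c1 : ∀ m : ℤ, m ≠ 0 → |m| < (P : ℤ) →
      (Finset.univ.filter (fun l => ((M l : ℕ) : ℤ) ∣ m)).card ≤ κ := by
    intro m hm hlt
    by_contra hc; push Not at hc
    obtain ⟨T, hTs, hT⟩ := Finset.exists_subset_card_eq (show κ + 1 ≤ _ from hc)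
    have h0 : ∏ l ∈ T, (M l : ℤ) ∣ m := by
      refine Finset.prod_dvd_of_coprime ?_ ?_
      · intro a _ b _ hab
        exact Nat.isCoprime_iff_coprime.2 (hcop a b hab)
      · intro l hl
        exact (Finset.mem_filter.1 (hTs hl)).2
    have h1 : ∏ l ∈ T, M l ∣ m.natAbs := by
      rw [← Int.natCast_dvd]; push_cast; exact h0
    have h2 := Nat.le_of_dvd (Int.natAbs_pos.2 hm) h1
    have h3 := prod_min hKL M hsm.monotone T hT
    rw [← hP] at h3
    have h5 : (P : ℤ) ≤ (m.natAbs : ℤ) := by exact_mod_cast h3.trans h2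
    rw [Int.natCast_natAbs] at h5
    linarith
  have c2 : (Finset.univ.filter (fun l => ((M l : ℕ) : ℤ) ∣ (P : ℤ))).card ≤ κ + 1 := by
    have hs : Finset.univ.filter (fun l => ((M l : ℕ) : ℤ) ∣ (P : ℤ)) ⊆
        Finset.univ.filter (fun l : Fin L => (l : ℕ) < κ + 1) := by
      intro l hl
      simp only [Finset.mem_filter, Finset.mem_univ, true_and] at hl ⊢
      by_contra hc
      have h1 : M l ∣ P := by exact_mod_cast hl
      have h2 : Nat.Coprime (M l) P := Nat.Coprime.prod_right fun j hj => hcop _ _ (by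
        rintro rfl
        exact hc (Finset.mem_filter.1 hj).2)
      have h3 : M l = 1 := Nat.Coprime.eq_one_of_dvd h2 h1
      have h4 := hmono ⟨0, by omega⟩ l (by rw [Fin.lt_def]; simp; omega)
      have := hMpos ⟨0, by omega⟩
      omega
    refine (Finset.card_le_card hs).trans ?_
    rw [filt_eq hKL]; simp
  let res : (Fin N → ℝ) → (Fin N → Fin L → ℝ) → Fin L → Multiset ℝ := fun X Δ l =>
    Multiset.map (fun i' => rmod (X i' + Δ i' l) ((Γ : ℝ) * (M l : ℝ))) Finset.univ.val
  let feas : (Fin L → Multiset ℝ) → (Fin N → ℝ) → Prop := fun R Y => ∃ Δ : Fin N → Fin L → ℝ,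
    (∀ i, Y i ∈ Set.Ico (0 : ℝ) ((Γ : ℝ) * ((P : ℕ) - 1))) ∧ (∀ i l, |Δ i l| < (Γ : ℝ) / 4) ∧ R = res Y Δ
  refine ⟨fun R => if h : ∃ Y, feas R Y then h.choose else 0, fun X Δ hX hΔ => ?_⟩
  have hex : ∃ Y, feas (res X Δ) Y := ⟨X, Δ, hX, hΔ, rfl⟩
  change ∃ σ : Equiv.Perm (Fin N), ∀ i, |(if h : ∃ Y, feas (res X Δ) Y then h.choose else 0) (σ i) - X i| < _
  rw [dif_pos hex]
  obtain ⟨Δ', hY, hΔ', hR⟩ := hex.choose_spec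
  set Y := hex.choose
  obtain ⟨π, hπ⟩ := real_match hN hNL κ (P : ℤ) (fun l => (M l : ℤ)) hL
    (fun l => by exact_mod_cast hMpos l) c1 c2 (fun i => X i / Γ) (fun i => Y i / Γ)
    (fun i => ⟨div_nonneg (hX i).1 hΓr.le, by
      rw [div_lt_iff₀ hΓr]; have := (hX i).2; push_cast at this ⊢; linarith⟩)
    (fun i => ⟨div_nonneg (hY i).1 hΓr.le, by
      rw [div_lt_iff₀ hΓr]; have := (hY i).2; push_cast at this ⊢; linarith⟩)
    (fun l => by
      obtain ⟨e, he⟩ := perm_of_map _ _ (congrFun hR l)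
      refine ⟨e, fun i => ?_⟩
      have h1 := he i
      simp only [rmod] at h1
      generalize ⌊(X i + Δ i l) / ((Γ : ℝ) * (M l : ℝ))⌋ = a at h1
      generalize ⌊(Y (e i) + Δ' (e i) l) / ((Γ : ℝ) * (M l : ℝ))⌋ = b at h1
      refine ⟨(a - b) * M l, Dvd.intro_left _ rfl, ?_⟩
      have h2 : X i / Γ - Y (e i) / Γ - (((a - b) * M l : ℤ) : ℝ) = (Δ' (e i) l - Δ i l) / Γ := by
        field_simp; push_cast; linarith
      rw [h2, abs_div, abs_of_pos hΓr, div_lt_iff₀ hΓr]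
      have h3 := abs_lt.1 (hΔ i l)
      have h4 := abs_lt.1 (hΔ' (e i) l)
      rw [abs_lt]; constructor <;> linarith)
  refine ⟨π, fun i => ?_⟩
  have h := hπ i
  rw [← sub_div, abs_div, abs_of_pos hΓr, div_le_iff₀ hΓr] at h
  rw [abs_sub_comm]
  linarith
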